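/- arXiv:2004.08088 — 2 statements merged into one kernel-verified Lean document; each statement's English description precedes it below -/
import Mathlib

section
/- Let Λ ⊂ ℂ be compact, and suppose z ∈ Λ is a deep point of Λ (i.e., there exists δ > 0 and C > 0 such that for all 0 < r < 1, every ball B(y,s) ⊂ B(z,r) \ Λ satisfies s ≤ C r^{1+δ}), and suppose ∂Λ is shallow (i.e., there exist constants c₁, c₂, c₃ > 0 such that for all w ∈ ∂Λ and 0 < r < 1 there is a ball B with B ∩ ∂Λ = ∅, c₁ r ≤ diam(B) ≤ c₂ r, and d(w, B) ≤ c₃ r). Then z is a measurable deep point of Λ: there exist δ' > 0 and C' > 0 such that area(B(z,r) \ Λ) ≤ C' r^{2+δ'} for all r > 0. -/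
open MeasureTheory Metric

/-- The closed square with lower left corner `a` and side `l`. -/
def dpSq (a : ℂ) (l : ℝ) : Set ℂ :=
  {x | a.re ≤ x.re ∧ x.re ≤ a.re + l ∧ a.im ≤ x.im ∧ x.im ≤ a.im + l}

/-- The lower left corner of a subsquare. -/
def dpC (a : ℂ) (m : ℝ) (i j : ℕ) : ℂ := ⟨a.re + i * m, a.im + j * m⟩

/-- The closed `e`-neighbourhood of `E`. -/
def dpN (E : Set ℂ) (e : ℝ) : Set ℂ := {x | ∃ w ∈ E, dist x w ≤ e}

lemma dp_one (n : ℕ) (hn : 0 < n) (m t : ℝ) (hm : 0 < m) (h0 : 0 ≤ t) (h1 : t ≤ n * m) :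
    ∃ i : Fin n, (i : ℕ) * m ≤ t ∧ t ≤ (i : ℕ) * m + m := by
  by_cases h : t < n * m
  · have h2 : t / m < n := by rwa [div_lt_iff₀ hm]
    have h3 : 0 ≤ t / m := by positivity
    refine ⟨⟨⌊t / m⌋₊, (Nat.floor_lt h3).2 h2⟩, ?_, ?_⟩
    · have := Nat.floor_le h3
      rwa [le_div_iff₀ hm] at this
    · have := (Nat.lt_floor_add_one (t / m)).le
      rw [div_le_iff₀ hm] at this
      simp only
      linarith
  · have h2 : t = n * m := le_antisymm h1 (not_lt.1 h)
    refine ⟨⟨n - 1, by omega⟩, ?_, ?_⟩ <;> simp only [Nat.cast_pred hn] <;> linarith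

lemma dp_cover (n : ℕ) (hn : 0 < n) (a : ℂ) (l : ℝ) (hl : 0 < l) (x : ℂ) (hx : x ∈ dpSq a l) :
    ∃ p : Fin n × Fin n, x ∈ dpSq (dpC a (l / n) p.1 p.2) (l / n) := by
  have hn' : (0:ℝ) < n := by exact_mod_cast hn
  have hm : 0 < l / n := by positivity
  have e : (n:ℝ) * (l / n) = l := by field_simp
  obtain ⟨h1, h2, h3, h4⟩ := hx
  obtain ⟨i, hi1, hi2⟩ := dp_one n hn (l / n) (x.re - a.re) hm (by linarith) (by linarith)
  obtain ⟨j, hj1, hj2⟩ := dp_one n hn (l / n) (x.im - a.im) hm (by linarith) (by linarith)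
  refine ⟨(i, j), ?_, ?_, ?_, ?_⟩ <;> simp only [dpC] <;> linarith

lemma dp_dist (a : ℂ) (l : ℝ) (x y : ℂ) (hx : x ∈ dpSq a l) (hy : y ∈ dpSq a l) :
    dist x y ≤ 2 * l := by
  obtain ⟨h1, h2, h3, h4⟩ := hx
  obtain ⟨g1, g2, g3, g4⟩ := hy
  rw [dist_eq_norm]
  refine (Complex.norm_le_abs_re_add_abs_im _).trans ?_
  have : |(x - y).re| ≤ l := by
    rw [Complex.sub_re, abs_le]; constructor <;> linarith
  have : |(x - y).im| ≤ l := by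
    rw [Complex.sub_im, abs_le]; constructor <;> linarith
  linarith

lemma dp_vol (a : ℂ) (l : ℝ) (hl : 0 < l) : volume (dpSq a l) ≤ ENNReal.ofReal (16 * l ^ 2) := by
  have h : dpSq a l ⊆ closedBall a (2 * l) := fun x hx =>
    dp_dist a l x a hx ⟨le_rfl, by linarith, le_rfl, by linarith⟩
  refine (measure_mono h).trans ?_
  rw [Complex.volume_closedBall]
  rw [← ENNReal.ofReal_pow (by positivity), ← ENNReal.ofReal_coe_nnreal,
    ← ENNReal.ofReal_mul (by positivity)]
  apply ENNReal.ofReal_le_ofReal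
  have := Real.pi_le_four
  simp only [NNReal.coe_real_pi]
  nlinarith [sq_nonneg l]

lemma dp_iter (E : Set ℂ) (n : ℕ) (hn : 0 < n) (e : ℝ)
    (hp : ∀ a : ℂ, ∀ l : ℝ, 0 < l → l ≤ 1 →
      ∃ y ∈ dpSq a l, ∀ w ∈ E, 4 * (l / n) ≤ dist y w) (k : ℕ) :
    ∀ a : ℂ, ∀ l : ℝ, 0 < l → l ≤ 1 → e ≤ l / (n:ℝ) ^ k →
      volume (dpSq a l ∩ dpN E e) ≤
        ((n * n - 1 : ℕ) : ENNReal) ^ k * ENNReal.ofReal (16 * (l / (n:ℝ) ^ k) ^ 2) := by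
  have hn' : (1:ℝ) ≤ n := by exact_mod_cast hn
  induction k with
  | zero =>
    intro a l hl hl1 _
    simpa using (measure_mono Set.inter_subset_left).trans (dp_vol a l hl)
  | succ k ih =>
    intro a l hl hl1 he
    have hm : 0 < l / n := by positivity
    have hm1 : l / n ≤ 1 := (div_le_self hl.le hn').trans hl1
    have hdiv : l / n / (n:ℝ) ^ k = l / (n:ℝ) ^ (k + 1) := by
      rw [div_div, pow_succ']
    obtain ⟨y, hy, hyE⟩ := hp a l hl hl1
    obtain ⟨p0, hp0⟩ := dp_cover n hn a l hl y hy
    have hem : e ≤ l / n := by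
      rw [← hdiv] at he
      exact he.trans (div_le_self hm.le (one_le_pow₀ hn'))
    have hsub : dpSq a l ∩ dpN E e ⊆
        ⋃ p ∈ (Finset.univ.erase p0 : Finset (Fin n × Fin n)),
          (dpSq (dpC a (l / n) p.1 p.2) (l / n) ∩ dpN E e) := by
      rintro x ⟨hx, hxN⟩
      obtain ⟨p, hpx⟩ := dp_cover n hn a l hl x hx
      have hne : p ≠ p0 := by
        rintro rfl
        obtain ⟨w, hw, hxw⟩ := hxN
        have h1 := hyE w hw
        have h2 := dp_dist _ _ y x hp0 hpx
        have h3 := dist_triangle y x w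
        linarith
      simp only [Set.mem_iUnion]
      exact ⟨p, by simp [hne], hpx, hxN⟩
    refine (measure_mono hsub).trans ((measure_biUnion_finset_le _ _).trans ?_)
    refine (Finset.sum_le_card_nsmul _ _ _ fun p _ =>
      ih (dpC a (l / n) p.1 p.2) (l / n) hm hm1 (by rw [hdiv]; exact he)).trans ?_
    rw [Finset.card_erase_of_mem (Finset.mem_univ _), Finset.card_univ, Fintype.card_prod,
      Fintype.card_fin, nsmul_eq_mul, hdiv, pow_succ' ((n * n - 1 : ℕ) : ENNReal), mul_assoc]

lemma dp_porous (E : Set ℂ)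
    (hshallow : ∃ c₁ > (0:ℝ), ∃ c₂ > (0:ℝ), ∃ c₃ > (0:ℝ),
      ∀ w ∈ E, ∀ r : ℝ, 0 < r → r < 1 →
        ∃ (y : ℂ) (s : ℝ), 0 < s ∧ ball y s ∩ E = ∅ ∧
          c₁ * r ≤ diam (ball y s) ∧ diam (ball y s) ≤ c₂ * r ∧
          infDist w (ball y s) ≤ c₃ * r) :
    ∃ n : ℕ, 2 ≤ n ∧ ∀ a : ℂ, ∀ l : ℝ, 0 < l → l ≤ 1 →
      ∃ y ∈ dpSq a l, ∀ w ∈ E, 4 * (l / n) ≤ dist y w := by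
  obtain ⟨c₁, h1, c₂, h2, c₃, h3, H⟩ := hshallow
  obtain ⟨κ, hκ, hκ1, hκ2⟩ : ∃ κ : ℝ, 0 < κ ∧ κ < 1 ∧ (c₂ + c₃) * κ ≤ 1 / 8 := by
    refine ⟨1 / (8 * (c₂ + c₃ + 1)), by positivity, ?_, ?_⟩
    · rw [div_lt_one (by positivity)]; linarith
    · rw [mul_one_div, div_le_div_iff₀ (by positivity) (by positivity)]; linarith
  obtain ⟨n, hn⟩ := exists_nat_ge (16 + 8 / (c₁ * κ))
  have hpos : 0 < 8 / (c₁ * κ) := by positivity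
  have hnR : (16:ℝ) ≤ n := by linarith
  have hn0 : (0:ℝ) < n := by linarith
  have hnc : 8 ≤ n * (c₁ * κ) := by
    rw [← div_le_iff₀ (by positivity)]; linarith
  refine ⟨n, by have : 16 ≤ n := by exact_mod_cast hnR
                omega, ?_⟩
  intro a l hl hl1
  set c : ℂ := ⟨a.re + l / 2, a.im + l / 2⟩ with hc
  have hin : ∀ y, dist y c ≤ l / 2 → y ∈ dpSq a l := by
    intro y hy
    rw [dist_eq_norm] at hy
    have hr := abs_le.1 ((Complex.abs_re_le_norm (y - c)).trans hy)
    have hi := abs_le.1 ((Complex.abs_im_le_norm (y - c)).trans hy)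
    simp only [Complex.sub_re, Complex.sub_im, hc] at hr hi
    refine ⟨?_, ?_, ?_, ?_⟩ <;> linarith [hr.1, hr.2, hi.1, hi.2]
  by_cases hw : ∃ w ∈ E, dist c w < l / 4
  · obtain ⟨w, hwE, hwc⟩ := hw
    obtain ⟨y, s, hs, hd, hd1, hd2, hd3⟩ := H w hwE (κ * l) (by positivity) (by nlinarith)
    have hdiam : diam (ball y s) = 2 * s := by
      simpa using Metric.diam_ball_eq y hs.le
    rw [hdiam] at hd1 hd2
    have hlt : infDist w (ball y s) < c₃ * (κ * l) + l / 16 := by linarith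
    obtain ⟨p, hp, hpw⟩ := (infDist_lt_iff ⟨y, mem_ball_self hs⟩).1 hlt
    have hpy : dist p y < s := hp
    have hk : (c₂ + c₃) * κ * l ≤ 1 / 8 * l := by gcongr
    have hwp : dist y c ≤ l / 2 := by
      have t1 := dist_triangle y p c
      have t2 := dist_triangle p w c
      rw [dist_comm y p, dist_comm p w] at *
      rw [dist_comm] at hwc
      nlinarith
    refine ⟨y, hin y hwp, ?_⟩
    intro v hv
    have hsv : s ≤ dist y v := by
      by_contra hcon
      have : v ∈ ball y s ∩ E := ⟨by rw [mem_ball, dist_comm]; linarith, hv⟩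
      rw [hd] at this
      exact this
    refine le_trans ?_ hsv
    have : 4 * (l / n) ≤ c₁ * (κ * l) / 2 := by
      rw [← mul_div_assoc, div_le_iff₀ hn0]
      nlinarith
    linarith
  · push Not at hw
    refine ⟨c, hin c (by simp; positivity), fun w hwE => le_trans ?_ (hw w hwE)⟩
    rw [← mul_div_assoc, div_le_iff₀ hn0]
    nlinarith

lemma dp_near (Λ : Set ℂ) (hΛ : IsCompact Λ) (z : ℂ) (hz : z ∈ Λ) (r e : ℝ)
    (hd : ∀ y : ℂ, ∀ s : ℝ, 0 < s → ball y s ⊆ ball z (2 * r) \ Λ → s ≤ e) :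
    ball z r \ Λ ⊆ dpN (frontier Λ) e := by
  rintro x ⟨hx, hxΛ⟩
  obtain ⟨w, hw, hwd⟩ := hΛ.exists_infDist_eq_dist ⟨z, hz⟩ x
  have hpos : 0 < dist x w := dist_pos.2 (by rintro rfl; exact hxΛ hw)
  have hball : ball x (dist x w) ⊆ Λᶜ := by
    intro v hv hvΛ
    have := infDist_le_dist_of_mem (x := x) hvΛ
    rw [mem_ball, dist_comm] at hv
    linarith
  have hle : dist x w ≤ dist x z := by
    rw [← hwd]; exact infDist_le_dist_of_mem hz
  have hx' : dist x z < r := hx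
  refine ⟨w, ?_, hd x _ hpos fun v hv => ⟨?_, hball hv⟩⟩
  · rw [frontier_eq_closure_inter_closure]
    refine ⟨subset_closure hw, closure_mono hball ?_⟩
    rw [closure_ball x hpos.ne', mem_closedBall, dist_comm]
  · have := dist_triangle v x z
    rw [mem_ball] at *
    linarith

/-- McMullen: a deep point of a compact set with shallow boundary is a measurable
deep point. -/
theorem stmt_10
    (Λ : Set ℂ) (hΛ : IsCompact Λ) (z : ℂ) (hz : z ∈ Λ)
    (hdeep : ∃ δ > (0:ℝ), ∃ C > (0:ℝ), ∀ r : ℝ, 0 < r → r < 1 →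
      ∀ y : ℂ, ∀ s : ℝ, 0 < s → ball y s ⊆ ball z r \ Λ → s ≤ C * r ^ (1 + δ))
    (hshallow : ∃ c₁ > (0:ℝ), ∃ c₂ > (0:ℝ), ∃ c₃ > (0:ℝ),
      ∀ w ∈ frontier Λ, ∀ r : ℝ, 0 < r → r < 1 →
        ∃ (y : ℂ) (s : ℝ), 0 < s ∧ ball y s ∩ frontier Λ = ∅ ∧
          c₁ * r ≤ diam (ball y s) ∧ diam (ball y s) ≤ c₂ * r ∧
          infDist w (ball y s) ≤ c₃ * r) :
    ∃ δ' > (0:ℝ), ∃ C' > (0:ℝ), ∀ r : ℝ, 0 < r →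
      (volume (ball z r \ Λ)).toReal ≤ C' * r ^ (2 + δ') := by
  obtain ⟨δ, hδ, C, hC, hdeep⟩ := hdeep
  obtain ⟨n, hn2, hp⟩ := dp_porous _ hshallow
  have hnR : (2:ℝ) ≤ n := by exact_mod_cast hn2
  have hn0 : (0:ℝ) < n := by linarith
  set q : ℝ := ((n:ℝ) * n - 1) / (n * n) with hq
  have hq0 : 0 < q := by
    apply div_pos <;> nlinarith
  have hq1 : q < 1 := by
    rw [hq, div_lt_one (by positivity)]; linarith
  set α : ℝ := - Real.log q / Real.log n with hα
  have hlogn : 0 < Real.log n := Real.log_pos (by linarith)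
  have hα0 : 0 < α := div_pos (by linarith [Real.log_neg hq0 hq1]) hlogn
  have hqα : (n:ℝ) ^ α = q⁻¹ := by
    rw [Real.rpow_def_of_pos hn0, hα, mul_div_cancel₀ _ hlogn.ne', Real.exp_neg, Real.exp_log hq0]
  -- main bound in terms of `l = 2 r`
  set B : ℝ := 16 * (q⁻¹ * C ^ α + 1 + C ^ α) with hB
  have hCα : 0 < C ^ α := by positivity
  have hB0 : 0 < B := by positivity
  have key : ∀ l : ℝ, 0 < l →
      (volume (ball z (l / 2) \ Λ)).toReal ≤ B * l ^ (2 + δ * α) := by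
    intro l hl
    have hball : ball z (l / 2) ⊆ dpSq (z - ⟨l / 2, l / 2⟩) l := by
      intro x hx
      rw [mem_ball, dist_eq_norm] at hx
      have hr := abs_le.1 ((Complex.abs_re_le_norm (x - z)).trans hx.le)
      have hi := abs_le.1 ((Complex.abs_im_le_norm (x - z)).trans hx.le)
      simp only [Complex.sub_re, Complex.sub_im] at hr hi
      refine ⟨?_, ?_, ?_, ?_⟩ <;> simp only [Complex.sub_re, Complex.sub_im] <;>
        linarith [hr.1, hr.2, hi.1, hi.2]
    have hsplit : l ^ (2 + δ * α) = l ^ 2 * (l ^ δ) ^ α := by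
      rw [Real.rpow_add hl, Real.rpow_mul hl.le]; norm_num
    have htriv : (volume (ball z (l / 2) \ Λ)).toReal ≤ 16 * l ^ 2 :=
      ENNReal.toReal_le_of_le_ofReal (by positivity)
        ((measure_mono (Set.sdiff_subset.trans hball)).trans (dp_vol _ l hl))
    rw [hsplit]
    have hl2 : 0 < l ^ 2 := by positivity
    have hlδ : 0 < l ^ δ := by positivity
    have hlα : 0 < (l ^ δ) ^ α := by positivity
    have hqi : 0 < q⁻¹ := by positivity
    by_cases hl1 : 1 ≤ l
    · have h1 : 1 ≤ (l ^ δ) ^ α :=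
        Real.one_le_rpow (Real.one_le_rpow hl1 hδ.le) hα0.le
      refine htriv.trans ?_
      have : 16 ≤ B := by rw [hB]; nlinarith [mul_pos hqi hCα]
      exact mul_le_mul this (le_mul_of_one_le_right hl2.le h1) hl2.le hB0.le
    push Not at hl1
    by_cases hCl : 1 < C * l ^ δ
    · have h1 : 1 ≤ C ^ α * (l ^ δ) ^ α := by
        rw [← Real.mul_rpow hC.le hlδ.le]
        exact Real.one_le_rpow hCl.le hα0.le
      refine htriv.trans ?_
      have : 16 * C ^ α ≤ B := by rw [hB]; nlinarith [mul_pos hqi hCα]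
      calc 16 * l ^ 2 ≤ 16 * l ^ 2 * (C ^ α * (l ^ δ) ^ α) :=
            le_mul_of_one_le_right (by positivity) h1
        _ = 16 * C ^ α * (l ^ 2 * (l ^ δ) ^ α) := by ring
        _ ≤ _ := by gcongr
    push Not at hCl
    have hCl0 : 0 < C * l ^ δ := by positivity
    obtain ⟨k, hk1, hk2⟩ := exists_nat_pow_near (x := (C * l ^ δ)⁻¹) (y := (n:ℝ))
      ((one_le_inv₀ hCl0).2 hCl) (by linarith)
    have hsub := dp_near Λ hΛ z hz (l / 2) (C * l ^ (1 + δ)) (by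
      intro y s hs hys
      rw [mul_div_cancel₀ l two_ne_zero] at hys
      exact hdeep l hl hl1 y s hs hys)
    have he : C * l ^ (1 + δ) ≤ l / (n:ℝ) ^ k := by
      rw [Real.rpow_add hl, Real.rpow_one, le_div_iff₀ (by positivity)]
      have := mul_le_mul_of_nonneg_left hk1 hCl0.le
      rw [mul_inv_cancel₀ hCl0.ne'] at this
      nlinarith
    have hvol := dp_iter _ n (by omega) _ hp k (z - ⟨l / 2, l / 2⟩) l hl hl1.le he
    have hvol2 := (measure_mono (Set.subset_inter (Set.sdiff_subset.trans hball) hsub)).trans hvol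
    have hcast : ((n * n - 1 : ℕ) : ENNReal) = ENNReal.ofReal ((n:ℝ) * n - 1) := by
      rw [← ENNReal.ofReal_natCast, Nat.cast_sub (by nlinarith)]
      push_cast; rfl
    have hnn : (0:ℝ) ≤ (n:ℝ) * n - 1 := by nlinarith
    rw [hcast, ← ENNReal.ofReal_pow hnn, ← ENNReal.ofReal_mul (by positivity)] at hvol2
    have hfin := ENNReal.toReal_le_of_le_ofReal (by positivity) hvol2
    have heq : ((n:ℝ) * n - 1) ^ k * (16 * (l / (n:ℝ) ^ k) ^ 2) = 16 * l ^ 2 * q ^ k := by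
      rw [hq, div_pow, div_pow, mul_pow]
      field_simp
    rw [heq] at hfin
    have hqk : q ^ k ≤ q⁻¹ * (C ^ α * (l ^ δ) ^ α) := by
      have h1 : ((C * l ^ δ)⁻¹) ^ α ≤ ((n:ℝ) ^ (k + 1)) ^ α :=
        Real.rpow_le_rpow (by positivity) hk2.le hα0.le
      rw [← Real.rpow_natCast, ← Real.rpow_mul hn0.le, mul_comm ((k + 1 : ℕ) : ℝ) α,
        Real.rpow_mul hn0.le, hqα, Real.rpow_natCast, Real.inv_rpow hCl0.le,
        Real.mul_rpow hC.le hlδ.le, inv_pow] at h1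
      have h2 := (inv_le_inv₀ (by positivity) (by positivity)).1 h1
      rw [← div_eq_inv_mul, le_div_iff₀ hq0, ← pow_succ]
      exact h2
    calc _ ≤ 16 * l ^ 2 * q ^ k := hfin
      _ ≤ 16 * l ^ 2 * (q⁻¹ * (C ^ α * (l ^ δ) ^ α)) := by gcongr
      _ = 16 * (q⁻¹ * C ^ α) * (l ^ 2 * (l ^ δ) ^ α) := by ring
      _ ≤ _ := by
        gcongr
        rw [hB]; linarith
  refine ⟨δ * α, by positivity, B * 2 ^ (2 + δ * α), by positivity, fun r hr => ?_⟩
  have := key (2 * r) (by positivity)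
  rw [mul_div_cancel_left₀ r two_ne_zero, Real.mul_rpow (by norm_num) hr.le, ← mul_assoc] at this
  exact this
end

section
/- Let Λ ⊂ ℂ be a compact shallow set: there exist constants c₁, c₂, c₃ > 0 such that for every z ∈ Λ and every 0 < r < 1 there is an open ball B ⊂ ℂ with B ∩ Λ = ∅, c₁ r ≤ diam(B) ≤ c₂ r, and d(z, B) ≤ c₃ r. Then the Hausdorff dimension of Λ is strictly less than 2; in particular, Λ has planar Lebesgue measure zero. -/
open MeasureTheory Metric

noncomputable section ShallowAux

/-- index of the half-open square of side `1/T` containing `z` -/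
def sqIdx (T : ℝ) (z : ℂ) : ℤ × ℤ := (⌊T * z.re⌋, ⌊T * z.im⌋)

lemma sqIdx_dist {T : ℝ} (hT : 0 < T) {z w : ℂ} (h : sqIdx T z = sqIdx T w) :
    T * dist z w < 2 := by
  simp only [sqIdx, Prod.mk.injEq] at h
  have h1 := Int.abs_sub_lt_one_of_floor_eq_floor h.1
  have h2 := Int.abs_sub_lt_one_of_floor_eq_floor h.2
  rw [← mul_sub, abs_mul, abs_of_pos hT] at h1 h2
  have h3 := Complex.norm_le_abs_re_add_abs_im (z - w)
  rw [Complex.dist_eq]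
  simp only [Complex.sub_re, Complex.sub_im] at h3
  have := mul_le_mul_of_nonneg_left h3 hT.le
  linarith

lemma sqIdx_parent (N : ℕ) (hN : 0 < N) (k : ℕ) (z : ℂ) :
    sqIdx ((N:ℝ) ^ k) z =
      ((sqIdx ((N:ℝ) ^ (k+1)) z).1 / (N:ℤ), (sqIdx ((N:ℝ) ^ (k+1)) z).2 / (N:ℤ)) := by
  have hN' : (N:ℝ) ≠ 0 := by positivity
  simp only [sqIdx]
  rw [← Int.floor_div_natCast, ← Int.floor_div_natCast]
  have e : ∀ x : ℝ, (N:ℝ) ^ k * x = (N:ℝ) ^ (k+1) * x / N := by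
    intro x; rw [pow_succ]; field_simp
  rw [← e, ← e]

lemma sqIdx_finite {Λ : Set ℂ} (hΛ : IsCompact Λ) (T : ℝ) (hT : 0 < T) :
    (sqIdx T '' Λ).Finite := by
  obtain ⟨R, hR⟩ := hΛ.isBounded.exists_norm_le
  refine ((Set.finite_Icc (⌊-(T * R)⌋) (⌊T * R⌋)).prod
    (Set.finite_Icc (⌊-(T * R)⌋) (⌊T * R⌋))).subset ?_
  rintro _ ⟨z, hz, rfl⟩
  have h1 := abs_le.1 ((Complex.abs_re_le_norm z).trans (hR z hz))
  have h2 := abs_le.1 ((Complex.abs_im_le_norm z).trans (hR z hz))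
  refine ⟨⟨Int.floor_mono ?_, Int.floor_mono ?_⟩, ⟨Int.floor_mono ?_, Int.floor_mono ?_⟩⟩ <;>
    nlinarith

/-- the key geometric step -/
lemma hole {Λ : Set ℂ} {c₁ c₂ c₃ : ℝ} (h1 : 0 < c₁) (h2 : 0 < c₂) (h3 : 0 < c₃)
    (H : ∀ z ∈ Λ, ∀ r : ℝ, 0 < r → r < 1 →
        ∃ (y : ℂ) (s : ℝ), 0 < s ∧ ball y s ∩ Λ = ∅ ∧
          c₁ * r ≤ diam (ball y s) ∧ diam (ball y s) ≤ c₂ * r ∧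
          infDist z (ball y s) ≤ c₃ * r) (m : ℕ) (hm : 2 ≤ m)
    (hmc : 16 * (c₂ + c₃ + 1) ≤ c₁ * (2 * m : ℕ)) (k : ℕ) (a b : ℤ) :
    ∃ p ∈ Finset.Ico (a * (2 * m : ℕ)) (a * (2 * m : ℕ) + (2 * m : ℕ)) ×ˢ
        Finset.Ico (b * (2 * m : ℕ)) (b * (2 * m : ℕ) + (2 * m : ℕ)),
      p ∉ sqIdx (((2 * m : ℕ) : ℝ) ^ (k+1)) '' Λ := by
  by_contra! hcon
  set N : ℕ := 2 * m with hNdef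
  have hNm : (N:ℝ) = 2 * m := by rw [hNdef]; push_cast; ring
  have hm' : (2:ℝ) ≤ m := by exact_mod_cast hm
  set T : ℝ := (N:ℝ) ^ (k+1) with hTdef
  set C := c₂ + c₃ + 1 with hC
  have hC1 : 1 < C := by linarith
  have hN1 : (4:ℝ) ≤ N := by linarith
  have hT : 0 < T := by positivity
  obtain ⟨z, hz, hzi⟩ := hcon (a * N + m, b * N + m) (by
    simp only [Finset.mem_product, Finset.mem_Ico]; omega)
  simp only [sqIdx, Prod.mk.injEq, Int.floor_eq_iff] at hzi
  push_cast at hzi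
  obtain ⟨⟨hx1, hx2⟩, hy1, hy2⟩ := hzi
  set r : ℝ := (N:ℝ) / (4 * C * T) with hr
  have hr0 : 0 < r := by positivity
  have hTr : T * r * C = N / 4 := by rw [hr]; field_simp
  have hTN : (N:ℝ) ≤ T := by
    rw [hTdef]; exact le_self_pow₀ (by linarith) (by omega)
  have hr1 : r < 1 := by
    rw [hr, div_lt_one (by positivity)]; nlinarith
  obtain ⟨y, s, hs, hdis, hd1, hd2, hinf⟩ := H z hz r hr0 hr1
  rw [diam_ball_eq y hs.le] at hd1 hd2
  obtain ⟨p, hp, hzp⟩ := (infDist_lt_iff (x := z) (r := (c₃ + 1) * r) ⟨y, mem_ball_self hs⟩).1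
    (by linarith)
  have hzy : dist z y < C * r := by
    have := dist_triangle z p y
    rw [mem_ball] at hp
    rw [hC]; nlinarith
  have hTzy : T * dist z y < N / 4 := by
    have := mul_lt_mul_of_pos_left hzy hT
    linarith
  have hTs : 2 ≤ T * s := by
    have e1 : T * (c₁ * r) ≤ T * (2 * s) := mul_le_mul_of_nonneg_left hd1 hT.le
    have e2 : T * (c₁ * r) * C = c₁ * N / 4 := by
      calc T * (c₁ * r) * C = c₁ * (T * r * C) := by ring
        _ = _ := by rw [hTr]; ring
    have e3 : 4 * C ≤ (T * (2 * s)) * C := by nlinarith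
    have := le_of_mul_le_mul_right e3 (by linarith)
    linarith
  have hre : |T * z.re - T * y.re| < N / 4 := by
    rw [← mul_sub, abs_mul, abs_of_pos hT]
    refine lt_of_le_of_lt (mul_le_mul_of_nonneg_left ?_ hT.le) hTzy
    rw [Complex.dist_eq]; exact Complex.abs_re_le_norm (z - y)
  have him : |T * z.im - T * y.im| < N / 4 := by
    rw [← mul_sub, abs_mul, abs_of_pos hT]
    refine lt_of_le_of_lt (mul_le_mul_of_nonneg_left ?_ hT.le) hTzy
    rw [Complex.dist_eq]; exact Complex.abs_im_le_norm (z - y)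
  rw [abs_lt] at hre him
  obtain ⟨w, hw, hwi⟩ := hcon (sqIdx T y) (by
    simp only [Finset.mem_product, Finset.mem_Ico, sqIdx, Int.le_floor, Int.floor_lt]
    push_cast
    refine ⟨⟨?_, ?_⟩, ?_, ?_⟩ <;> linarith)
  have hwy := sqIdx_dist hT hwi
  have : w ∈ ball y s ∩ Λ := by
    refine ⟨?_, hw⟩
    rw [mem_ball]
    exact lt_of_mul_lt_mul_left (hwy.trans_le hTs) hT.le
  rw [hdis] at this
  exact this

lemma count {Λ : Set ℂ} (hΛ : IsCompact Λ) (N : ℕ) (hN : 0 < N)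
    (hole : ∀ (k : ℕ) (a b : ℤ), ∃ p ∈ Finset.Ico (a * N) (a * N + N) ×ˢ
        Finset.Ico (b * N) (b * N + N), p ∉ sqIdx ((N : ℝ) ^ (k+1)) '' Λ) (k : ℕ) :
    (sqIdx ((N:ℝ) ^ k) '' Λ).ncard ≤ (N ^ 2 - 1) ^ k * (sqIdx 1 '' Λ).ncard := by
  induction k with
  | zero => simp
  | succ k ih =>
    have hf : ∀ k : ℕ, (sqIdx ((N:ℝ) ^ k) '' Λ).Finite := fun k =>
      sqIdx_finite hΛ _ (by positivity)
    rw [Set.ncard_eq_toFinset_card _ (hf (k+1))]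
    rw [Set.ncard_eq_toFinset_card _ (hf k)] at ih
    have := Finset.card_le_mul_card_image_of_maps_to (s := (hf (k+1)).toFinset)
      (t := (hf k).toFinset) (f := fun p : ℤ × ℤ => (p.1 / (N:ℤ), p.2 / (N:ℤ))) (by
        intro p hp
        simp only [Set.Finite.coe_toFinset, Set.Finite.mem_toFinset] at hp ⊢
        obtain ⟨z, hz, rfl⟩ := hp
        exact ⟨z, hz, sqIdx_parent N hN k z⟩) (N ^ 2 - 1) (by
        rintro ⟨a, b⟩ -
        obtain ⟨p, hp, hpn⟩ := hole k a b
        have hsub : {x ∈ (hf (k+1)).toFinset | (x.1 / (N:ℤ), x.2 / (N:ℤ)) = (a, b)} ⊆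
            (Finset.Ico (a * N) (a * N + N) ×ˢ Finset.Ico (b * N) (b * N + N)).erase p := by
          intro x hx
          simp only [Finset.mem_filter, Set.Finite.mem_toFinset, Prod.mk.injEq] at hx
          obtain ⟨hx, rfl, rfl⟩ := hx
          rw [Finset.mem_erase]
          refine ⟨fun h => hpn (h ▸ hx), ?_⟩
          have hN' : (0:ℤ) < N := by exact_mod_cast hN
          simp only [Finset.mem_product, Finset.mem_Ico]
          have e1 := Int.ediv_mul_add_emod x.1 N
          have e2 := Int.ediv_mul_add_emod x.2 N
          have e3 := Int.emod_nonneg x.1 hN'.ne'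
          have e4 := Int.emod_nonneg x.2 hN'.ne'
          have e5 := Int.emod_lt_of_pos x.1 hN'
          have e6 := Int.emod_lt_of_pos x.2 hN'
          refine ⟨⟨?_, ?_⟩, ?_, ?_⟩ <;> linarith
        refine (Finset.card_le_card hsub).trans ?_
        rw [Finset.card_erase_of_mem hp, Finset.card_product, Int.card_Ico, Int.card_Ico]
        simp [pow_two])
    refine this.trans ?_
    rw [pow_succ (N ^ 2 - 1) k, mul_comm (_ ^ k), mul_assoc]
    exact Nat.mul_le_mul_left _ ih

lemma dim_lt {Λ : Set ℂ} (hΛ : IsCompact Λ) (N : ℕ) (hN : 2 ≤ N) (K : ℕ)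
    (hc : ∀ k : ℕ, (sqIdx ((N:ℝ) ^ k) '' Λ).ncard ≤ (N ^ 2 - 1) ^ k * K) :
    dimH Λ < 2 := by
  have hN2 : (2:ℝ) ≤ N := by exact_mod_cast hN
  have hN0 : (0:ℝ) < N := by linarith
  have hM : ((N ^ 2 - 1 : ℕ) : ℝ) = (N:ℝ) ^ 2 - 1 := by
    rw [Nat.cast_sub (Nat.one_le_pow _ _ (by omega))]; push_cast; ring
  set d : ℝ := Real.logb N ((N:ℝ) ^ 2 - 1) with hd
  have hNd : (N:ℝ) ^ d = (N:ℝ) ^ 2 - 1 :=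
    Real.rpow_logb hN0 (by linarith) (by nlinarith)
  have hd0 : 0 ≤ d := Real.logb_nonneg (by linarith) (by nlinarith)
  have hd2 : d < 2 := by
    rw [hd, Real.logb_lt_iff_lt_rpow (by linarith) (by nlinarith)]
    norm_num
  have hf : ∀ k : ℕ, (sqIdx ((N:ℝ) ^ k) '' Λ).Finite := fun k =>
      sqIdx_finite hΛ _ (by positivity)
  let t : ∀ k : ℕ, (hf k).toFinset → Set ℂ := fun k i => {z | sqIdx ((N:ℝ) ^ k) z = i}
  have hdiam : ∀ k i, ediam (t k i) ≤ ENNReal.ofReal (2 / (N:ℝ) ^ k) := by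
    intro k i
    refine ediam_le fun z hz w hw => ?_
    rw [edist_dist]
    refine ENNReal.ofReal_le_ofReal ?_
    have hT : (0:ℝ) < (N:ℝ) ^ k := by positivity
    rw [le_div_iff₀ hT, mul_comm]
    exact (sqIdx_dist hT (Eq.trans hz (Eq.symm hw))).le
  have hmeas : (Measure.hausdorffMeasure d : Measure ℂ) Λ ≤ ENNReal.ofReal (K * 2 ^ d) := by
    refine (Measure.hausdorffMeasure_le_liminf_sum (l := Filter.atTop) d Λ
      (fun k => ENNReal.ofReal (2 / (N:ℝ) ^ k)) ?_ t ?_ ?_).trans ?_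
    · rw [← ENNReal.ofReal_zero]
      refine ENNReal.tendsto_ofReal ?_
      exact Filter.Tendsto.const_div_atTop
        (tendsto_pow_atTop_atTop_of_one_lt (by linarith)) _
    · exact Filter.Eventually.of_forall hdiam
    · refine Filter.Eventually.of_forall fun k z hz => ?_
      rw [Set.mem_iUnion]
      exact ⟨⟨sqIdx ((N:ℝ) ^ k) z, by
        rw [Set.Finite.mem_toFinset]; exact ⟨z, hz, rfl⟩⟩, rfl⟩
    · refine Filter.liminf_le_of_le (by isBoundedDefault) ?_
      intro b hb
      obtain ⟨k, hk⟩ := hb.exists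
      refine hk.trans ?_
      have hT : (0:ℝ) < (N:ℝ) ^ k := by positivity
      calc ∑ i, ediam (t k i) ^ d
          ≤ ∑ i : (hf k).toFinset, ENNReal.ofReal ((2 / (N:ℝ) ^ k) ^ d) := by
            refine Finset.sum_le_sum fun i _ => ?_
            rw [← ENNReal.ofReal_rpow_of_nonneg (by positivity) hd0]
            exact ENNReal.rpow_le_rpow (hdiam k i) hd0
        _ = ENNReal.ofReal ((sqIdx ((N:ℝ) ^ k) '' Λ).ncard * (2 / (N:ℝ) ^ k) ^ d) := by
            rw [ENNReal.ofReal_mul (by positivity), ENNReal.ofReal_natCast,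
              Set.ncard_eq_toFinset_card _ (hf k)]
            simp
        _ ≤ ENNReal.ofReal (K * 2 ^ d) := by
            refine ENNReal.ofReal_le_ofReal ?_
            have hck : ((sqIdx ((N:ℝ) ^ k) '' Λ).ncard : ℝ) ≤ ((N:ℝ) ^ 2 - 1) ^ k * K := by
              rw [← hM]; exact_mod_cast hc k
            have e : ((N:ℝ) ^ k) ^ d = ((N:ℝ) ^ 2 - 1) ^ k := by
              rw [← hNd, Real.rpow_pow_comm hN0.le]
            have hp : (0:ℝ) < ((N:ℝ) ^ 2 - 1) ^ k := pow_pos (by nlinarith) k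
            rw [Real.div_rpow (by norm_num) hT.le, e]
            calc _ ≤ ((N:ℝ) ^ 2 - 1) ^ k * K * (2 ^ d / ((N:ℝ) ^ 2 - 1) ^ k) := by gcongr
              _ = _ := by field_simp
  clear_value d
  lift d to NNReal using hd0
  have hle : dimH Λ ≤ (d : ENNReal) :=
    dimH_le_of_hausdorffMeasure_ne_top (ne_top_of_le_ne_top ENNReal.ofReal_ne_top hmeas)
  refine hle.trans_lt ?_
  have : d < 2 := by exact_mod_cast hd2
  exact_mod_cast this

lemma vol_zero {Λ : Set ℂ} (h : dimH Λ < 2) : volume Λ = 0 := by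
  have h0 : (Measure.hausdorffMeasure ((2 : NNReal) : ℝ) : Measure ℂ) Λ = 0 :=
    hausdorffMeasure_of_dimH_lt (by exact_mod_cast h)
  have e : ((2 : NNReal) : ℝ) = (Module.finrank ℝ ℂ : ℕ) := by
    rw [Complex.finrank_real_complex]; norm_num
  rw [e] at h0
  exact Measure.absolutelyContinuous_isAddHaarMeasure volume
    (Measure.hausdorffMeasure (Module.finrank ℝ ℂ : ℕ)) h0

end ShallowAux

/-- A compact shallow set in the plane has Hausdorff dimension strictly less than 2,
and in particular zero area. -/
theorem stmt_11
    (Λ : Set ℂ) (hΛ : IsCompact Λ)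
    (hshallow : ∃ c₁ > (0:ℝ), ∃ c₂ > (0:ℝ), ∃ c₃ > (0:ℝ),
      ∀ z ∈ Λ, ∀ r : ℝ, 0 < r → r < 1 →
        ∃ (y : ℂ) (s : ℝ), 0 < s ∧ ball y s ∩ Λ = ∅ ∧
          c₁ * r ≤ diam (ball y s) ∧ diam (ball y s) ≤ c₂ * r ∧
          infDist z (ball y s) ≤ c₃ * r) :
    dimH Λ < 2 ∧ volume Λ = 0 := by
  obtain ⟨c₁, h1, c₂, h2, c₃, h3, H⟩ := hshallow
  obtain ⟨n, hn⟩ := exists_nat_ge (16 * (c₂ + c₃ + 1) / c₁)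
  have hmc : 16 * (c₂ + c₃ + 1) ≤ c₁ * (2 * (n + 2) : ℕ) := by
    rw [div_le_iff₀ h1] at hn
    push_cast
    nlinarith [mul_nonneg h1.le (Nat.cast_nonneg (α := ℝ) n)]
  have hlt : dimH Λ < 2 := dim_lt hΛ (2 * (n + 2)) (by omega) _
    (count hΛ (2 * (n + 2)) (by omega) (hole h1 h2 h3 H (n + 2) (by omega) hmc))
  exact ⟨hlt, vol_zero hlt⟩
end
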